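/- Let \(\mathsf{D}\) be a finite-dimensional graded division algebra with center \(\mathsf{F}\) and canonical subalgebra \(\mathsf{C}=C_{\mathsf{D}}(\mathsf{U})\). Let \(\mathsf{A},\mathsf{B}\) be graded subalgebras of \(\mathsf{D}\) containing \(\mathsf{F}\) such that \(\mathsf{A}\) is a graded field and \(\mathsf{B}\subseteq\mathsf{C}\), and set \(\mathsf{A}'=\mathsf{A}\cap C_{\mathsf{D}}(\mathsf{B})\). Then \(\mathsf{A}\) is totally ramified over \(\mathsf{A}'\) and \([\mathsf{A}:\mathsf{A}']\le[\mathsf{B}:\mathsf{A}\cap\mathsf{B}]\). -/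

import Mathlib

noncomputable section

namespace GradedDivPaper

variable {Γ : Type*} [AddCommGroup Γ] [DecidableEq Γ]
variable {D : Type*} [Ring D]

/-- The (additive) group `Γ` is torsion-free. -/
def TorsionFree (Γ : Type*) [AddCommGroup Γ] : Prop :=
  ∀ (γ : Γ) (n : ℕ), n ≠ 0 → n • γ = 0 → γ = 0

/-- A `Γ`-graded ring is a graded division ring if `1 ≠ 0` and every nonzero
homogeneous element is a unit. -/
def IsGradedDivisionRing (𝒜 : Γ → AddSubgroup D) [GradedRing 𝒜] : Prop :=
  (0 : D) ≠ 1 ∧ ∀ (γ : Γ), ∀ x ∈ 𝒜 γ, x ≠ 0 → IsUnit x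

/-- A subring `E` of a graded ring is a graded subring if it contains all homogeneous
components of each of its elements. -/
def IsGradedSubring (𝒜 : Γ → AddSubgroup D) [GradedRing 𝒜] (E : Subring D) : Prop :=
  ∀ x ∈ E, ∀ γ : Γ, (DirectSum.decompose 𝒜 x γ : D) ∈ E

/-- A graded subring which is itself a graded division ring (nonzero homogeneous elements
of `E` are invertible in `E`). -/
def IsGradedDivSubring (𝒜 : Γ → AddSubgroup D) [GradedRing 𝒜] (E : Subring D) : Prop :=
  IsGradedSubring 𝒜 E ∧
    ∀ (γ : Γ), ∀ x ∈ E, x ∈ 𝒜 γ → x ≠ 0 → ∃ y ∈ E, x * y = 1 ∧ y * x = 1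

/-- A graded subfield: a commutative graded division subring. -/
def IsGradedSubfield (𝒜 : Γ → AddSubgroup D) [GradedRing 𝒜] (K : Subring D) : Prop :=
  IsGradedDivSubring 𝒜 K ∧ ∀ x ∈ K, ∀ y ∈ K, x * y = y * x

/-- The grade set `Γ_E` of a subring `E`: the degrees in which `E` has nonzero
homogeneous elements. -/
def gradeSet (𝒜 : Γ → AddSubgroup D) (E : Subring D) : Set Γ :=
  {γ : Γ | ∃ x : D, x ∈ E ∧ x ∈ 𝒜 γ ∧ x ≠ 0}

/-- The index `|A : B|` of subsets of `Γ`: the number of classes of `A` modulo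
translation by `B`. -/
def addSetIndex (A B : Set Γ) : ℕ :=
  Nat.card (Quot (fun x y : A => (x : Γ) - (y : Γ) ∈ B))

/-- `[R : S]`: the rank of the ring `R` as a module over a subring `S`. -/
def dimOver {R : Type*} [Ring R] (S : Subring R) : ℕ := Module.finrank S R

/-- `R` has finite rank over the subring `S`. -/
def finiteOver {R : Type*} [Ring R] (S : Subring R) : Prop := Module.Finite S R

/-- `[A : B]`: the rank of a subring `A` of `R` over a subring `B` (i.e. over `B ∩ A`). -/
def relDim {R : Type*} [Ring R] (B A : Subring R) : ℕ :=
  Module.finrank (B.comap A.subtype) A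

/-- The degree-0 component of a graded ring, as a subring. -/
def grade0 (𝒜 : Γ → AddSubgroup D) [GradedRing 𝒜] : Subring D where
  carrier := 𝒜 0
  zero_mem' := (𝒜 0).zero_mem
  add_mem' := fun ha hb => (𝒜 0).add_mem ha hb
  neg_mem' := fun ha => (𝒜 0).neg_mem ha
  one_mem' := SetLike.one_mem_graded 𝒜
  mul_mem' := fun ha hb => by simpa using SetLike.mul_mem_graded ha hb

/-- `L/F` is a Galois extension (inside an ambient ring `R`): `F ≤ L` and `F` is exactly
the fixed ring of the group of ring automorphisms of `L` fixing `F` pointwise. -/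
def IsGaloisExt {R : Type*} [Ring R] (F L : Subring R) : Prop :=
  F ≤ L ∧ ∀ x : L,
    (∀ σ : L ≃+* L, (∀ y : L, (y : R) ∈ F → σ y = y) → σ x = x) → (x : R) ∈ F

/-- `p` is the minimal polynomial of `c` over the subring `F`: the monic polynomial with
coefficients in `F` annihilating `c` of least degree. -/
def IsMinPolyOf {R : Type*} [Ring R] (F : Subring R) (c : R) (p : Polynomial F) : Prop :=
  p.Monic ∧ Polynomial.eval₂ F.subtype c p = 0 ∧
    ∀ q : Polynomial F, q.Monic → Polynomial.eval₂ F.subtype c q = 0 → p.degree ≤ q.degree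

/-- The polynomial `p` over `F` splits into linear factors over `L`. -/
def SplitsIn {R : Type*} [Ring R] {F L : Subring R} (h : F ≤ L) (p : Polynomial F) : Prop :=
  ∃ s : List L,
    p.map (Subring.inclusion h) = (s.map fun a => Polynomial.X - Polynomial.C a).prod

/-- Normality for an extension of graded subfields: the minimal polynomial over `F` of
every homogeneous element of `L` splits over `L`. -/
def IsNormalExtGr (𝒜 : Γ → AddSubgroup D) [GradedRing 𝒜] (F L : Subring D) : Prop :=
  ∃ h : F ≤ L, ∀ c ∈ L, (∃ γ : Γ, c ∈ 𝒜 γ) →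
    ∀ p : Polynomial F, IsMinPolyOf F c p → SplitsIn h p

/-- Normality for an (ungraded) extension of subfields: the minimal polynomial over `F`
of every element of `L` splits over `L`. -/
def IsNormalExt {R : Type*} [Ring R] (F L : Subring R) : Prop :=
  ∃ h : F ≤ L, ∀ c ∈ L, ∀ p : Polynomial F, IsMinPolyOf F c p → SplitsIn h p

/-- `K` is a (commutative) subfield of the subring `A`. -/
def IsSubfieldOf {R : Type*} [Ring R] (A K : Subring R) : Prop :=
  K ≤ A ∧ (∀ x ∈ K, ∀ y ∈ K, x * y = y * x) ∧
    ∀ x ∈ K, x ≠ 0 → ∃ y ∈ K, x * y = 1 ∧ y * x = 1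

/-- `K` is a maximal subfield of the subring `A`. -/
def IsMaxSubfieldOf {R : Type*} [Ring R] (A K : Subring R) : Prop :=
  IsSubfieldOf A K ∧ ∀ K' : Subring R, IsSubfieldOf A K' → K ≤ K' → K' = K

/-- `T` is a maximal graded subfield of the graded subring `A`. -/
def IsMaxGradedSubfieldOf (𝒜 : Γ → AddSubgroup D) [GradedRing 𝒜] (A T : Subring D) : Prop :=
  IsGradedSubfield 𝒜 T ∧ T ≤ A ∧
    ∀ T' : Subring D, IsGradedSubfield 𝒜 T' → T' ≤ A → T ≤ T' → T' = T

/-- The canonical subalgebra `𝖴 = 𝖣₀ ⊗_{𝖥₀} 𝖥`: the subring generated by `𝖣₀` and `𝖥`. -/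
def Uc (𝒜 : Γ → AddSubgroup D) [GradedRing 𝒜] (F : Subring D) : Subring D :=
  grade0 𝒜 ⊔ F

/-- The canonical subalgebra `𝖹 = Z(𝖣₀) ⊗_{𝖥₀} 𝖥`: the subring generated by the center
of `𝖣₀` and `𝖥`. -/
def Zc (𝒜 : Γ → AddSubgroup D) [GradedRing 𝒜] (F : Subring D) : Subring D :=
  (Subring.centralizer (grade0 𝒜 : Set D) ⊓ grade0 𝒜) ⊔ F

/-- The canonical subalgebra `𝖢 = C_𝖣(𝖴)`. -/
def Cc (𝒜 : Γ → AddSubgroup D) [GradedRing 𝒜] (F : Subring D) : Subring D :=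
  Subring.centralizer (Uc 𝒜 F : Set D)

/-- The canonical subalgebra `𝖤 = C_𝖣(𝖹)`. -/
def Ec (𝒜 : Γ → AddSubgroup D) [GradedRing 𝒜] (F : Subring D) : Subring D :=
  Subring.centralizer (Zc 𝒜 F : Set D)

end GradedDivPaper

namespace GradedDivPaper

section HomogeneousUnits

variable {Γ : Type*} [AddCommGroup Γ] [DecidableEq Γ] {D : Type*} [Ring D]

theorem inv_mem_of_mem (𝒜 : Γ → AddSubgroup D) [GradedRing 𝒜] {u : Dˣ} {γ : Γ}
    (hu : (u : D) ∈ 𝒜 γ) : ((u⁻¹ : Dˣ) : D) ∈ 𝒜 (-γ) := by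
  have h := DirectSum.coe_decompose_mul_add_of_left_mem 𝒜 (j := -γ)
    (b := ((u⁻¹ : Dˣ) : D)) hu
  rw [add_neg_cancel, Units.mul_inv,
    DirectSum.decompose_of_mem_same 𝒜 (SetLike.one_mem_graded 𝒜)] at h
  have h' : ((u⁻¹ : Dˣ) : D) = DirectSum.decompose 𝒜 ((u⁻¹ : Dˣ) : D) (-γ) := by
    rw [← mul_one ((u⁻¹ : Dˣ) : D)]
    conv_lhs => rw [h, Units.inv_mul_cancel_left]
    rw [mul_one]
  rw [h']
  exact SetLike.coe_mem _

/-- The homogeneous units of `D` lying in the subring `E`. -/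
def homogeneousUnits (𝒜 : Γ → AddSubgroup D) [GradedRing 𝒜] (E : Subring D) :
    Submonoid Dˣ where
  carrier := {u | (u : D) ∈ E ∧ ∃ γ, (u : D) ∈ 𝒜 γ}
  one_mem' := ⟨by simp [E.one_mem], 0, by simpa using SetLike.one_mem_graded 𝒜⟩
  mul_mem' := by
    rintro u v ⟨hu, γ, hγ⟩ ⟨hv, δ, hδ⟩
    exact ⟨by simpa using E.mul_mem hu hv, γ + δ, by
      simpa using SetLike.mul_mem_graded hγ hδ⟩

theorem conj_mem_zero (𝒜 : Γ → AddSubgroup D) [GradedRing 𝒜] {u : Dˣ} {γ : Γ}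
    (hu : (u : D) ∈ 𝒜 γ) {x : D} (hx : x ∈ 𝒜 0) :
    ((u⁻¹ : Dˣ) : D) * x * u ∈ 𝒜 0 := by
  simpa using SetLike.mul_mem_graded (SetLike.mul_mem_graded (inv_mem_of_mem 𝒜 hu) hx) hu

theorem commutator_mem_zero (𝒜 : Γ → AddSubgroup D) [GradedRing 𝒜] {a u : Dˣ} {γ δ : Γ}
    (ha : (a : D) ∈ 𝒜 γ) (hu : (u : D) ∈ 𝒜 δ) :
    (a * u * ((a⁻¹ : Dˣ) : D) * ((u⁻¹ : Dˣ) : D)) ∈ 𝒜 0 := by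
  have h := SetLike.mul_mem_graded (SetLike.mul_mem_graded (SetLike.mul_mem_graded ha hu)
    (inv_mem_of_mem 𝒜 ha)) (inv_mem_of_mem 𝒜 hu)
  have e : γ + δ + -γ + -δ = 0 := by abel
  rwa [e] at h

theorem commutator_commute (𝒜 : Γ → AddSubgroup D) [GradedRing 𝒜] {a u : Dˣ} {γ : Γ}
    (ha : (a : D) ∈ 𝒜 γ) (hu : ∀ x ∈ 𝒜 0, Commute x (u : D)) {x : D} (hx : x ∈ 𝒜 0) :
    Commute x (a * u * ((a⁻¹ : Dˣ) : D) * ((u⁻¹ : Dˣ) : D)) := by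
  have h1 : Commute x (a * u * ((a⁻¹ : Dˣ) : D)) := by
    have h := (hu _ (conj_mem_zero 𝒜 ha hx)).eq
    calc x * (a * u * ((a⁻¹ : Dˣ) : D))
        = a * ((((a⁻¹ : Dˣ) : D) * x * a) * u) * ((a⁻¹ : Dˣ) : D) := by
          simp [mul_assoc]
      _ = a * u * ((a⁻¹ : Dˣ) : D) * x := by rw [h]; simp [mul_assoc]
  exact h1.mul_right (hu x hx).units_inv_right

/-- The commutator with a homogeneous unit `a`, as a character of the homogeneous units of a
subring centralizing the degree-zero part. -/
def commutatorHom (𝒜 : Γ → AddSubgroup D) [GradedRing 𝒜] {B : Subring D}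
    (hB : ∀ x ∈ 𝒜 0, ∀ b ∈ B, Commute x b) (a : Dˣ) (ha : ∃ γ, (a : D) ∈ 𝒜 γ) :
    homogeneousUnits 𝒜 B →* Subring.center (grade0 𝒜) where
  toFun u := ⟨⟨a * (u : Dˣ) * ((a⁻¹ : Dˣ) : D) * (((u : Dˣ)⁻¹ : Dˣ) : D),
      commutator_mem_zero 𝒜 ha.choose_spec u.2.2.choose_spec⟩, by
    rw [Subring.mem_center_iff]
    exact fun x => Subtype.ext
      (commutator_commute 𝒜 ha.choose_spec (fun y hy => hB y hy _ u.2.1) x.2)⟩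
  map_one' := by ext; simp
  map_mul' u v := by
    ext
    have h := hB _ (commutator_mem_zero 𝒜 ha.choose_spec v.2.2.choose_spec) _ u.2.1
    have h' := h.units_inv_right.eq
    simp only [Submonoid.coe_mul, Units.val_mul, mul_inv_rev, Subring.coe_mul]
    calc _ = a * (u : Dˣ) * ((a⁻¹ : Dˣ) : D) * ((a * (v : Dˣ) * ((a⁻¹ : Dˣ) : D) *
          (((v : Dˣ)⁻¹ : Dˣ) : D)) * (((u : Dˣ)⁻¹ : Dˣ) : D)) := by simp [mul_assoc]
      _ = _ := by rw [h']; simp [mul_assoc]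

theorem commutatorHom_mul (𝒜 : Γ → AddSubgroup D) [GradedRing 𝒜] {B : Subring D}
    (hB : ∀ x ∈ 𝒜 0, ∀ b ∈ B, Commute x b) (a : Dˣ) (ha : ∃ γ, (a : D) ∈ 𝒜 γ)
    (u : homogeneousUnits 𝒜 B) :
    ((commutatorHom 𝒜 hB a ha u : grade0 𝒜) : D) * (u : Dˣ) =
      a * (u : Dˣ) * ((a⁻¹ : Dˣ) : D) := by
  simp [commutatorHom]

theorem isDomain_center_grade0 (𝒜 : Γ → AddSubgroup D) [GradedRing 𝒜]
    (hD : IsGradedDivisionRing 𝒜) : IsDomain (Subring.center (grade0 𝒜)) := by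
  have : Nontrivial D := ⟨0, 1, hD.1⟩
  have : NoZeroDivisors (Subring.center (grade0 𝒜)) := ⟨by
    intro x y hxy
    by_contra! h
    have hu : IsUnit ((x : grade0 𝒜) : D) := hD.2 0 _ (x : grade0 𝒜).2 (by simpa using h.1)
    have h0 : ((x : grade0 𝒜) : D) * ((y : grade0 𝒜) : D) = 0 := by
      simpa using congrArg (fun z : Subring.center (grade0 𝒜) => ((z : grade0 𝒜) : D)) hxy
    exact h.2 (by simpa using (hu.mul_right_eq_zero).1 h0)⟩
  exact NoZeroDivisors.to_isDomain _

/-- If `D` is finite over its center, then a subring containing the center has finite rank over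
any other such subring. -/
theorem rank_comap_lt_aleph0 [Nontrivial D] (hfin : finiteOver (Subring.center D))
    (K B : Subring D) (hK : Subring.center D ≤ K) (hB : Subring.center D ≤ B) :
    Module.rank (K.comap B.subtype) B < Cardinal.aleph0 := by
  have : Module.Finite (Subring.center D) D := hfin
  refine (rank_le (n := Module.finrank (Subring.center D) D) fun s hs => ?_).trans_lt
    (Cardinal.natCast_lt_aleph0)
  have h : LinearIndependent (Subring.center D) (fun i : s => ((i : B) : D)) := by
    rw [Fintype.linearIndependent_iff] at hs ⊢
    intro g hg i
    have := hs (fun i => ⟨⟨g i, hB (g i).2⟩, hK (g i).2⟩) (by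
      ext
      simpa [Subring.smul_def] using hg) i
    exact Subtype.ext (congrArg (fun z : K.comap B.subtype => ((z : B) : D)) this)
  simpa using h.fintype_card_le_finrank

end HomogeneousUnits

section Characters

variable {Γ : Type*} [AddCommGroup Γ] [DecidableEq Γ] {D : Type*} [Ring D]

theorem sum_commutatorHom_eq_zero (𝒜 : Γ → AddSubgroup D) [GradedRing 𝒜]
    (hD : IsGradedDivisionRing 𝒜) {A B : Subring D} (hA : ∀ x ∈ A, ∀ y ∈ A, x * y = y * x)
    (hB : ∀ x ∈ 𝒜 0, ∀ b ∈ B, Commute x b) {ι : Type*} [Fintype ι]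
    (a : ι → homogeneousUnits 𝒜 A) (l : ι → Subring.center (grade0 𝒜))
    {J : Set (homogeneousUnits 𝒜 B)}
    (hJ : ∀ u ∈ J, ∑ i, l i * commutatorHom 𝒜 hB (a i) (a i).2.2 u = 0)
    {u : homogeneousUnits 𝒜 B} {k : (A ⊓ B).comap B.subtype} (hk : k ≠ 0)
    (hu : k • (⟨_, u.2.1⟩ : B) ∈ Submodule.span ((A ⊓ B).comap B.subtype)
      ((fun v : homogeneousUnits 𝒜 B => (⟨_, v.2.1⟩ : B)) '' J)) :
    ∑ i, l i * commutatorHom 𝒜 hB (a i) (a i).2.2 u = 0 := by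
  let φ : B → D := fun b => ∑ i, ((l i : grade0 𝒜) : D) *
    (((a i : Dˣ) : D) * b * (((a i : Dˣ)⁻¹ : Dˣ) : D))
  have φ_unit (v : homogeneousUnits 𝒜 B) : φ ⟨_, v.2.1⟩ =
      (((∑ i, l i * commutatorHom 𝒜 hB (a i) (a i).2.2 v :
        Subring.center (grade0 𝒜)) : grade0 𝒜) : D) * ((v : Dˣ) : D) := by
    have h := map_sum ((grade0 𝒜).subtype.comp (Subring.center (grade0 𝒜)).subtype)
      (fun i => l i * commutatorHom 𝒜 hB (a i) (a i).2.2 v) Finset.univ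
    simp only [RingHom.comp_apply, Subring.subtype_apply] at h
    rw [h, Finset.sum_mul]
    refine Finset.sum_congr rfl fun i _ => ?_
    rw [← commutatorHom_mul 𝒜 hB _ (a i).2.2 v, ← mul_assoc]
    rfl
  have φ_smul (c : (A ⊓ B).comap B.subtype) (b : B) : φ (c • b) = ((c : B) : D) * φ b := by
    simp only [φ, Finset.mul_sum]
    refine Finset.sum_congr rfl fun i _ => ?_
    have h1 : ((a i : Dˣ) : D) * ((c : B) : D) = ((c : B) : D) * ((a i : Dˣ) : D) :=
      hA _ (a i).2.1 _ c.2.1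
    have h2 : ((l i : grade0 𝒜) : D) * ((c : B) : D) = ((c : B) : D) * ((l i : grade0 𝒜) : D) :=
      (hB _ (l i : grade0 𝒜).2 _ c.1.2).eq
    have h3 : ((c • b : B) : D) = ((c : B) : D) * b := rfl
    rw [h3]
    simp only [← mul_assoc]
    rw [← h2, mul_assoc _ _ ((c : B) : D), h1, ← mul_assoc]
  have φ_span : ∀ b ∈ Submodule.span ((A ⊓ B).comap B.subtype)
      ((fun v : homogeneousUnits 𝒜 B => (⟨_, v.2.1⟩ : B)) '' J), φ b = 0 := by
    intro b hb
    induction hb using Submodule.span_induction with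
    | mem x hx =>
      obtain ⟨v, hv, rfl⟩ := hx
      simp [φ_unit, hJ v hv]
    | zero => simp [φ]
    | add x y _ _ hx hy =>
      have : φ (x + y) = φ x + φ y := by
        simp [φ, mul_add, add_mul, Finset.sum_add_distrib]
      rw [this, hx, hy, add_zero]
    | smul c x _ hx => rw [φ_smul, hx, mul_zero]
  have h := φ_span _ hu
  rw [φ_smul, φ_unit, ← mul_assoc] at h
  have h' := (Units.mul_left_eq_zero _).1 h
  by_contra hne
  have hunit := hD.2 0 _ (((∑ i, l i * commutatorHom 𝒜 hB (a i) (a i).2.2 u :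
        Subring.center (grade0 𝒜)) : grade0 𝒜)).2 (by
    intro h0
    exact hne (Subtype.ext (Subtype.ext h0)))
  exact hk (Subtype.ext (Subtype.ext ((hunit.mul_left_eq_zero).1 h')))

theorem card_range_commutatorHom_le (𝒜 : Γ → AddSubgroup D) [GradedRing 𝒜]
    (hD : IsGradedDivisionRing 𝒜) {A B : Subring D} (hA : ∀ x ∈ A, ∀ y ∈ A, x * y = y * x)
    (hB : ∀ x ∈ 𝒜 0, ∀ b ∈ B, Commute x b)
    (hrank : Module.rank ((A ⊓ B).comap B.subtype) B < Cardinal.aleph0) :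
    (Set.range fun a : homogeneousUnits 𝒜 A => commutatorHom 𝒜 hB a a.2.2).Finite ∧
    (Set.range fun a : homogeneousUnits 𝒜 A => commutatorHom 𝒜 hB a a.2.2).ncard ≤
      relDim (A ⊓ B) B := by
  have := isDomain_center_grade0 𝒜 hD
  have : Nontrivial D := ⟨0, 1, hD.1⟩
  obtain ⟨J, hJ, hmax⟩ := exists_maximal_linearIndepOn ((A ⊓ B).comap B.subtype)
    (fun v : homogeneousUnits 𝒜 B => (⟨_, v.2.1⟩ : B))
  have hJenc := hJ.encard_le_toENat_rank
  have hrk : ((relDim (A ⊓ B) B : ℕ) : ℕ∞) =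
      (Module.rank ((A ⊓ B).comap B.subtype) B).toENat := by
    rw [relDim, Module.finrank, ← Cardinal.toENat_nat, Cardinal.cast_toNat_of_lt_aleph0 hrank]
  rw [← hrk] at hJenc
  have hJfin : J.Finite := Set.finite_of_encard_le_coe hJenc
  have hJcard : J.ncard ≤ relDim (A ⊓ B) B := by
    rw [← hJfin.cast_ncard_eq] at hJenc
    exact_mod_cast hJenc
  have := hJfin.fintype
  let R := Set.range fun a : homogeneousUnits 𝒜 A => commutatorHom 𝒜 hB a a.2.2
  let v : R → (J → Subring.center (grade0 𝒜)) := fun χ u => χ.1 u.1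
  have hv : LinearIndependent (Subring.center (grade0 𝒜)) v := by
    have hded := (linearIndependent_monoidHom (homogeneousUnits 𝒜 B)
      (Subring.center (grade0 𝒜))).comp (fun χ : R => χ.1) Subtype.val_injective
    rw [linearIndependent_iff'] at hded ⊢
    intro s g hg
    refine hded s g ?_
    choose a ha using fun χ : R => χ.2
    have key (u : homogeneousUnits 𝒜 B) : (∑ χ ∈ s, g χ * χ.1 u) =
        ∑ i : s, g i * commutatorHom 𝒜 hB (a i) (a i).2.2 u := by
      rw [← Finset.sum_coe_sort s]
      exact Finset.sum_congr rfl fun i _ => by rw [← ha i]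
    have hJ0 : ∀ u ∈ J, ∑ i : s, g i * commutatorHom 𝒜 hB (a i) (a i).2.2 u = 0 := by
      intro u hu
      rw [← key]
      simpa [v] using congrFun hg ⟨u, hu⟩
    funext u
    have : ∑ χ ∈ s, g χ * χ.1 u = 0 := by
      by_cases hu : u ∈ J
      · rw [key]; exact hJ0 u hu
      · obtain ⟨k, hk, hmem⟩ := hmax u hu
        rw [key]
        exact sum_commutatorHom_eq_zero 𝒜 hD hA hB _ _ hJ0 hk hmem
    simpa using this
  have hfinR : Finite R := hv.finite
  have := Fintype.ofFinite R
  refine ⟨Set.toFinite R, le_trans ?_ hJcard⟩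
  have h := hv.fintype_card_le_finrank
  rw [Module.finrank_fintype_fun_eq_card] at h
  rwa [← Nat.card_eq_fintype_card, ← Nat.card_eq_fintype_card, Nat.card_coe_set_eq,
    Nat.card_coe_set_eq] at h

theorem exists_homogeneousUnits (𝒜 : Γ → AddSubgroup D) [GradedRing 𝒜] {A : Subring D}
    (hA : IsGradedSubfield 𝒜 A) {γ : Γ} {x : D} (hx : x ∈ A) (hγ : x ∈ 𝒜 γ) (h0 : x ≠ 0) :
    ∃ u : homogeneousUnits 𝒜 A, ((u : Dˣ) : D) = x ∧ (((u : Dˣ)⁻¹ : Dˣ) : D) ∈ A := by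
  obtain ⟨y, hy, hxy, hyx⟩ := hA.1.2 γ x hx hγ h0
  exact ⟨⟨⟨x, y, hxy, hyx⟩, hx, γ, hγ⟩, rfl, hy⟩

theorem mem_centralizer_of_homogeneous (𝒜 : Γ → AddSubgroup D) [GradedRing 𝒜]
    (hD : IsGradedDivisionRing 𝒜) {B : Subring D} (hB : IsGradedSubring 𝒜 B) {c : D}
    (h : ∀ u : homogeneousUnits 𝒜 B, ((u : Dˣ) : D) * c = c * ((u : Dˣ) : D)) :
    c ∈ Subring.centralizer (B : Set D) := by
  classical
  rw [Subring.mem_centralizer_iff]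
  intro b hb
  rw [← DirectSum.sum_support_decompose 𝒜 b, Finset.sum_mul, Finset.mul_sum]
  refine Finset.sum_congr rfl fun γ hγ => ?_
  have hne : (DirectSum.decompose 𝒜 b γ : D) ≠ 0 := by simpa using hγ
  obtain ⟨u, hu⟩ := hD.2 γ _ (SetLike.coe_mem _) hne
  have := h ⟨u, by rw [hu]; exact hB b hb γ, γ, by rw [hu]; exact SetLike.coe_mem _⟩
  simpa [hu] using this

theorem mul_inv_mem_centralizer (𝒜 : Γ → AddSubgroup D) [GradedRing 𝒜]
    (hD : IsGradedDivisionRing 𝒜) {A B : Subring D} (hA : IsGradedSubfield 𝒜 A)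
    (hBgr : IsGradedSubring 𝒜 B) (hB : ∀ x ∈ 𝒜 0, ∀ b ∈ B, Commute x b)
    {a c : homogeneousUnits 𝒜 A} (hc : (((c : Dˣ)⁻¹ : Dˣ) : D) ∈ A)
    (h : commutatorHom 𝒜 hB a a.2.2 = commutatorHom 𝒜 hB c c.2.2) :
    ((a : Dˣ) : D) * (((c : Dˣ)⁻¹ : Dˣ) : D) ∈ Subring.centralizer (B : Set D) := by
  refine mem_centralizer_of_homogeneous 𝒜 hD hBgr fun u => ?_
  have h1 : ((a : Dˣ) : D) * (u : Dˣ) * (((a : Dˣ)⁻¹ : Dˣ) : D) =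
      ((c : Dˣ) : D) * (u : Dˣ) * (((c : Dˣ)⁻¹ : Dˣ) : D) := by
    rw [← commutatorHom_mul 𝒜 hB a a.2.2, ← commutatorHom_mul 𝒜 hB c c.2.2, h]
  have h2 : (a : Dˣ) * u * (a : Dˣ)⁻¹ = (c : Dˣ) * u * (c : Dˣ)⁻¹ := by
    ext; simpa using h1
  have h3 : (a : Dˣ) * (c : Dˣ)⁻¹ = (c : Dˣ)⁻¹ * (a : Dˣ) := by
    ext; simpa using hA.2 _ a.2.1 _ hc
  have h4 : (u : Dˣ) * (a * (c : Dˣ)⁻¹) = a * (c : Dˣ)⁻¹ * u := by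
    have h5 : (c : Dˣ)⁻¹ * a * u = u * ((c : Dˣ)⁻¹ * a) := by
      calc (c : Dˣ)⁻¹ * a * u = (c : Dˣ)⁻¹ * (a * u * (a : Dˣ)⁻¹) * a := by group
        _ = _ := by rw [h2]; group
    rw [h3, h5]
  simpa using congrArg Units.val h4

theorem relDim_centralizer_le_ncard (𝒜 : Γ → AddSubgroup D) [GradedRing 𝒜]
    (hD : IsGradedDivisionRing 𝒜) {A B : Subring D} (hA : IsGradedSubfield 𝒜 A)
    (hBgr : IsGradedSubring 𝒜 B) (hB : ∀ x ∈ 𝒜 0, ∀ b ∈ B, Commute x b)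
    (hfin : (Set.range fun a : homogeneousUnits 𝒜 A => commutatorHom 𝒜 hB a a.2.2).Finite) :
    relDim (A ⊓ Subring.centralizer (B : Set D)) A ≤
      (Set.range fun a : homogeneousUnits 𝒜 A => commutatorHom 𝒜 hB a a.2.2).ncard := by
  classical
  let R := Set.range fun a : homogeneousUnits 𝒜 A => commutatorHom 𝒜 hB a a.2.2
  have : Nontrivial D := ⟨0, 1, hD.1⟩
  let A' := (A ⊓ Subring.centralizer (B : Set D)).comap A.subtype
  let : CommRing A' := { (inferInstance : Ring A') with
    mul_comm := fun x y => Subtype.ext (Subtype.ext (hA.2 _ x.1.2 _ y.1.2)) }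
  have : Fintype R := hfin.fintype
  choose a ha using fun χ : R => χ.2
  have hainv (χ : R) : (((a χ : Dˣ)⁻¹ : Dˣ) : D) ∈ A := by
    obtain ⟨γ, hγ⟩ := (a χ).2.2
    obtain ⟨u, hu, hu'⟩ := exists_homogeneousUnits 𝒜 hA (a χ).2.1 hγ (Units.ne_zero _)
    rwa [← Units.ext hu]
  have hspan : Submodule.span A' (Set.range fun χ : R => (⟨_, (a χ).2.1⟩ : A)) = ⊤ := by
    rw [eq_top_iff]
    rintro x -
    have hx : x = ∑ γ ∈ (DirectSum.decompose 𝒜 (x : D)).support,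
        (⟨_, hA.1.1 x x.2 γ⟩ : A) := by
      ext
      rw [AddSubmonoidClass.coe_finsetSum]
      exact (DirectSum.sum_support_decompose 𝒜 (x : D)).symm
    rw [hx]
    refine Submodule.sum_mem _ fun γ hγ => ?_
    have hne : (DirectSum.decompose 𝒜 (x : D) γ : D) ≠ 0 := by simpa using hγ
    obtain ⟨u, hu, -⟩ := exists_homogeneousUnits 𝒜 hA (hA.1.1 x x.2 γ) (SetLike.coe_mem _) hne
    let χ : R := ⟨_, u, rfl⟩
    have hmem := mul_inv_mem_centralizer 𝒜 hD hA hBgr hB (hainv χ) (ha χ).symm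
    have hmemA := A.mul_mem u.2.1 (hainv χ)
    have : (⟨_, hA.1.1 x x.2 γ⟩ : A) =
        (⟨⟨_, hmemA⟩, hmemA, hmem⟩ : A') • (⟨_, (a χ).2.1⟩ : A) := by
      ext
      change _ = ((u : Dˣ) : D) * (((a χ : Dˣ)⁻¹ : Dˣ) : D) * ((a χ : Dˣ) : D)
      simp [hu]
    rw [this]
    exact Submodule.smul_mem _ _ (Submodule.subset_span ⟨χ, rfl⟩)
  have h := finrank_le_of_span_eq_top hspan
  rwa [← Nat.card_eq_fintype_card, Nat.card_coe_set_eq] at h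

end Characters

/-- for graded subalgebras `A`, `B` of `D` containing `F` with `A` a
graded field and `B ⊆ 𝖢`, setting `A' = A ⊓ C_D(B)`, the extension `A/A'` is totally
ramified and `[A : A'] ≤ [B : A ⊓ B]`. -/
theorem stmt_12 {Γ : Type*} [AddCommGroup Γ] [DecidableEq Γ] {D : Type*} [Ring D]
    (hΓ : TorsionFree Γ) (𝒜 : Γ → AddSubgroup D) [GradedRing 𝒜]
    (hD : IsGradedDivisionRing 𝒜)
    (F : Subring D) (hFcen : F = Subring.center D) (hfin : finiteOver F)
    (A B : Subring D) (hA : IsGradedSubfield 𝒜 A) (hB : IsGradedSubring 𝒜 B)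
    (hFA : F ≤ A) (hFB : F ≤ B) (hBC : B ≤ Cc 𝒜 F) :
    A ⊓ grade0 𝒜 = (A ⊓ Subring.centralizer (B : Set D)) ⊓ grade0 𝒜 ∧
    relDim (A ⊓ Subring.centralizer (B : Set D)) A ≤ relDim (A ⊓ B) B := by
  have hB0 : ∀ x ∈ 𝒜 0, ∀ b ∈ B, Commute x b := fun x hx b hb =>
    Subring.mem_centralizer_iff.1 (hBC hb) x
      ((le_sup_left : grade0 𝒜 ≤ Uc 𝒜 F) hx)
  have : Nontrivial D := ⟨0, 1, hD.1⟩
  subst hFcen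
  refine ⟨?_, ?_⟩
  · refine le_antisymm (fun x hx => ⟨⟨hx.1, ?_⟩, hx.2⟩) (inf_le_inf_right _ inf_le_left)
    exact Subring.mem_centralizer_iff.2 fun b hb => (hB0 x hx.2 b hb).eq.symm
  · obtain ⟨hfinite, hcard⟩ := card_range_commutatorHom_le 𝒜 hD hA.2 hB0
      (rank_comap_lt_aleph0 hfin (A ⊓ B) B (le_inf hFA hFB) hFB)
    exact (relDim_centralizer_le_ncard 𝒜 hD hA hB hB0 hfinite).trans hcard

end GradedDivPaper
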